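/- Among unstable positive integers other than 1, the number 107 has the smallest defect: 107 is unstable, and every unstable integer n > 1 with n ≠ 107 satisfies δ(n) > δ(107). -/

import Mathlib

/-- `CanWrite n k` means the positive integer `n` can be written using exactly `k` ones
combined by addition and multiplication. -/
inductive CanWrite : ℕ → ℕ → Prop
  | one : CanWrite 1 1
  | add {a b j k : ℕ} : CanWrite a j → CanWrite b k → CanWrite (a + b) (j + k)
  | mul {a b j k : ℕ} : CanWrite a j → CanWrite b k → CanWrite (a * b) (j + k)

/-- The integer complexity `‖n‖`: the least number of ones needed to write `n`. -/
noncomputable def cpx (n : ℕ) : ℕ := sInf {k | CanWrite n k}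

/-- The defect `δ(n) = ‖n‖ - 3 log₃ n`. -/
noncomputable def defect (n : ℕ) : ℝ := (cpx n : ℝ) - 3 * Real.logb 3 n

/-- `n` is stable if `‖3^k n‖ = 3k + ‖n‖` for all `k ≥ 0`. -/
def Stable (n : ℕ) : Prop := ∀ k : ℕ, cpx (3 ^ k * n) = 3 * k + cpx n

/-- The stabilization length `K(n)`: the least `k` such that `3^k n` is stable. -/
noncomputable def stabLen (n : ℕ) : ℕ := sInf {k | Stable (3 ^ k * n)}

/-- The stable complexity `‖n‖_st`: equal to `‖3^k n‖ - 3k` for any `k` with `3^k n` stable. -/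
noncomputable def stableCpx (n : ℕ) : ℕ :=
  sInf {m | ∃ k : ℕ, Stable (3 ^ k * n) ∧ cpx (3 ^ k * n) = m + 3 * k}

/-- The stable defect `δ_st(n) = ‖n‖_st - 3 log₃ n`. -/
noncomputable def stableDefect (n : ℕ) : ℝ := (stableCpx n : ℝ) - 3 * Real.logb 3 n


/-! ### Basic facts about `cpx` -/

lemma CanWrite.pos {n k : ℕ} (h : CanWrite n k) : 1 ≤ n ∧ 1 ≤ k := by
  induction h with
  | one => simp
  | add _ _ h1 h2 => omega
  | mul _ _ h1 h2 => exact ⟨Nat.mul_pos h1.1 h2.1, by omega⟩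

lemma canWrite_self (n : ℕ) (hn : 1 ≤ n) : CanWrite n n := by
  induction n, hn using Nat.le_induction with
  | base => exact CanWrite.one
  | succ n _ ih => exact CanWrite.add ih CanWrite.one

lemma cpx_spec {n : ℕ} (hn : 1 ≤ n) : CanWrite n (cpx n) :=
  Nat.sInf_mem (s := {k | CanWrite n k}) ⟨n, canWrite_self n hn⟩

lemma cpx_le {n k : ℕ} (h : CanWrite n k) : cpx n ≤ k := Nat.sInf_le h

lemma cpx_le_self {n : ℕ} (hn : 1 ≤ n) : cpx n ≤ n := cpx_le (canWrite_self n hn)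

lemma cpx_add_le {a b : ℕ} (ha : 1 ≤ a) (hb : 1 ≤ b) : cpx (a + b) ≤ cpx a + cpx b :=
  cpx_le (CanWrite.add (cpx_spec ha) (cpx_spec hb))

lemma cpx_mul_le {a b : ℕ} (ha : 1 ≤ a) (hb : 1 ≤ b) : cpx (a * b) ≤ cpx a + cpx b :=
  cpx_le (CanWrite.mul (cpx_spec ha) (cpx_spec hb))

/-- The lower bound `n ^ 3 ≤ 3 ^ ‖n‖`. -/
lemma CanWrite.cube_le {n k : ℕ} (h : CanWrite n k) : n ^ 3 ≤ 3 ^ k := by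
  have key : ∀ a j : ℕ, CanWrite a j → a ^ 3 ≤ 3 ^ j → ∀ k, 1 ≤ k → (a + 1) ^ 3 ≤ 3 ^ (j + k) := by
    intro a j hw ha k hk
    have h0 := hw.pos
    have h3 : 3 ^ (j + 1) ≤ 3 ^ (j + k) := Nat.pow_le_pow_right (by norm_num) (by omega)
    refine le_trans ?_ h3
    rcases lt_or_ge a 3 with h | h
    · have hj : a ≤ j := by
        by_contra hc
        obtain rfl : j = 1 := by omega
        obtain rfl : a = 2 := by omega
        norm_num at ha
      have : 3 ^ (a + 1) ≤ 3 ^ (j + 1) := Nat.pow_le_pow_right (by norm_num) (by omega)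
      refine le_trans ?_ this
      interval_cases a
      all_goals omega
    · rw [pow_succ 3]
      obtain ⟨d, rfl⟩ := Nat.exists_eq_add_of_le h
      have h5 : (3 + d + 1) ^ 3 ≤ 3 * (3 + d) ^ 3 := by
        ring_nf
        nlinarith [Nat.zero_le d, Nat.zero_le (d ^ 2), Nat.zero_le (d ^ 3)]
      omega
  induction h with
  | one => norm_num
  | @add a b j k h1 h2 ih1 ih2 =>
    have p1 := h1.pos
    have p2 := h2.pos
    rcases Nat.lt_or_ge b 2 with hb | hb
    · obtain rfl : b = 1 := by omega
      exact key a j h1 ih1 k p2.2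
    rcases Nat.lt_or_ge a 2 with ha | ha
    · obtain rfl : a = 1 := by omega
      have := key b k h2 ih2 j p1.2
      rwa [add_comm 1 b, add_comm j k]
    · have : a + b ≤ a * b := by nlinarith
      calc (a + b) ^ 3 ≤ (a * b) ^ 3 := Nat.pow_le_pow_left this 3
        _ = a ^ 3 * b ^ 3 := by ring
        _ ≤ 3 ^ j * 3 ^ k := Nat.mul_le_mul ih1 ih2
        _ = 3 ^ (j + k) := by ring
  | @mul a b j k h1 h2 ih1 ih2 =>
    calc (a * b) ^ 3 = a ^ 3 * b ^ 3 := by ring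
      _ ≤ 3 ^ j * 3 ^ k := Nat.mul_le_mul ih1 ih2
      _ = 3 ^ (j + k) := by ring

lemma cube_le_cpx {n : ℕ} (hn : 1 ≤ n) : n ^ 3 ≤ 3 ^ cpx n := (cpx_spec hn).cube_le

lemma cpx_step {n : ℕ} (hn : 2 ≤ n) :
    (∃ a b, 2 ≤ a ∧ 2 ≤ b ∧ n = a * b ∧ cpx n = cpx a + cpx b) ∨
    (∃ a b, 1 ≤ b ∧ b ≤ a ∧ n = a + b ∧ cpx n = cpx a + cpx b) := by
  have hw := cpx_spec (n := n) (by omega)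
  generalize hk : cpx n = k at hw
  cases hw with
  | one => omega
  | @add a b j l h1 h2 =>
    right
    have p1 := h1.pos
    have p2 := h2.pos
    have c1 := cpx_le h1
    have c2 := cpx_le h2
    have := cpx_add_le p1.1 p2.1
    rcases le_total b a with h | h
    · exact ⟨a, b, p2.1, h, rfl, by omega⟩
    · exact ⟨b, a, p1.1, h, by omega, by omega⟩
  | @mul a b j l h1 h2 =>
    left
    have p1 := h1.pos
    have p2 := h2.pos
    have c1 := cpx_le h1
    have c2 := cpx_le h2
    have := cpx_mul_le p1.1 p2.1
    have ha : a ≠ 1 := by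
      rintro rfl
      rw [one_mul] at hk
      omega
    have hb : b ≠ 1 := by
      rintro rfl
      rw [mul_one] at hk
      omega
    exact ⟨a, b, by omega, by omega, rfl, by omega⟩

/-- A number of small defect is a most-efficient product, or its predecessor is cheaper by one. -/
lemma cpx_step_small {n : ℕ} (hn : 2 ≤ n) (hE : 3 ^ cpx n ≤ 12 * n ^ 3) :
    (∃ a b, 2 ≤ a ∧ 2 ≤ b ∧ n = a * b ∧ cpx n = cpx a + cpx b) ∨
    (cpx n = cpx (n - 1) + 1) := by
  rcases cpx_step hn with h | ⟨a, b, hb, hab, rfl, hc⟩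
  · exact Or.inl h
  right
  have hb4 : cpx b ≤ 4 := by
    by_contra hcon
    have h1 := cube_le_cpx (n := a) (by omega)
    have h2 : 3 ^ 5 ≤ 3 ^ cpx b := Nat.pow_le_pow_right (by norm_num) (by omega)
    have h3 : (a + b) ^ 3 ≤ (2 * a) ^ 3 := Nat.pow_le_pow_left (by omega) 3
    rw [hc, pow_add] at hE
    have h4 := Nat.mul_le_mul h1 h2
    have : 1 ≤ a ^ 3 := Nat.one_le_pow _ _ (by omega)
    rw [mul_pow] at h3
    omega
  have hb5 : b ≤ 4 := by
    have h1 := cube_le_cpx hb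
    have h2 : 3 ^ cpx b ≤ 3 ^ 4 := Nat.pow_le_pow_right (by norm_num) hb4
    by_contra hcon
    have : 5 ^ 3 ≤ b ^ 3 := Nat.pow_le_pow_left (by omega) 3
    omega
  have hbb : b ≤ cpx b := by
    have h1 := cube_le_cpx hb
    by_contra hcon
    have h2 : 3 ^ cpx b ≤ 3 ^ (b - 1) := Nat.pow_le_pow_right (by norm_num) (by omega)
    have h3 : b ^ 3 ≤ 3 ^ (b - 1) := h1.trans h2
    have := (cpx_spec hb).pos
    interval_cases b
    all_goals omega
  have hup : cpx (a + b) ≤ cpx (a + b - 1) + 1 := by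
    have h1 := cpx_add_le (a := a + b - 1) (b := 1) (by omega) le_rfl
    have h2 := cpx_le_self (n := 1) le_rfl
    rw [show a + b - 1 + 1 = a + b by omega] at h1
    omega
  rcases Nat.lt_or_ge b 2 with h | h
  · obtain rfl : b = 1 := by omega
    rw [Nat.add_sub_cancel] at hup ⊢
    omega
  · have h1 := cpx_add_le (a := a) (b := b - 1) (by omega) (by omega)
    have h2 := cpx_le_self (n := b - 1) (by omega)
    rw [show a + (b - 1) = a + b - 1 by omega] at h1
    omega

/-! ### A table of complexities up to 683 -/

/-- The complexities of the numbers up to 683, packed in base 32. -/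
def cpxPacked : ℕ :=
  2360631621763948814321141194379902728380713374830288606327342618288953421228641542326689997142402688116838159364937096343831625769499404365077666841380021759028743433170855747941992199499209521557423727774409679759839635229318089008586355209097143504869972488271516292380431641559250170495302983764972160073399865731376399299960599679125253138660395781048563958009840661273480113258480449510992810808613155006186684389748571885081234569451231336999494353988910932585304426065686297406043195600933878607313691766376193831622439743840964136527223077216272758181555050101094824393544171857565417247614288219784721613789632148579686886704415184093806368493553687101573025986603159089502976314628400804149664756149763115911080290579501333626192116229939852173017299022345859161432194560188371227849825221070794742575274393749716183003373751251126830877397713197675945310152516979488082611947163508272684439530954709662221309162658753713830994572380394665616551997162077122573548776639455854416538103865500609615645187195848221293381664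

/-- Table lookup. -/
def tab (n : ℕ) : ℕ := cpxPacked / 32 ^ n % 32

lemma tab_add_le : ∀ a < 47, ∀ b < min 684 (2187 / a + 1),
    a = 0 ∨ 684 ≤ a + b ∨ tab (a + b) ≤ tab a + tab b := by
  decide +kernel

lemma tab_max : ∀ n < 684, tab n ≤ 22 := by
  decide +kernel

lemma tab_mul_le : ∀ a < 27, ∀ b < 683 / a + 1, a = 0 ∨ b = 0 ∨ tab (a * b) ≤ tab a + tab b := by
  decide +kernel

lemma tab_wit : ∀ n < 684, 2 ≤ n → (tab (n - 1) + tab 1 = tab n) ∨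
    ∃ a < 27, 2 ≤ a ∧ ((a < n ∧ tab (n - a) + tab a = tab n) ∨ (a * (n / a) = n ∧ tab a + tab (n / a) = tab n)) := by
  decide +kernel

lemma tab_le {n k : ℕ} (h : CanWrite n k) (hn : n < 684) : tab n ≤ k := by
  induction h with
  | one => decide +kernel
  | @add a b j k h1 h2 ih1 ih2 =>
    have p1 := h1.pos
    have p2 := h2.pos
    have i1 := ih1 (by omega)
    have i2 := ih2 (by omega)
    by_contra hcon
    have hmax := tab_max (a + b) hn
    have hab : a * b ≤ 2187 := by
      have h3 := Nat.mul_le_mul h1.cube_le h2.cube_le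
      rw [← mul_pow, ← pow_add] at h3
      have h4 : 3 ^ (j + k) ≤ 3 ^ 21 := Nat.pow_le_pow_right (by norm_num) (by omega)
      have h5 : (a * b) ^ 3 ≤ 2187 ^ 3 := by omega
      exact (Nat.pow_le_pow_iff_left (by norm_num)).1 h5
    have key : ∀ a b : ℕ, 1 ≤ a → a ≤ b → a + b < 684 → a * b ≤ 2187 →
        tab (a + b) ≤ tab a + tab b := by
      intro a b ha hab hlt hm
      have h47 : a < 47 := by nlinarith
      have hb : b ≤ 2187 / a := (Nat.le_div_iff_mul_le (by omega)).2 (by nlinarith)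
      have := tab_add_le a h47 b (by omega)
      omega
    rcases le_total a b with h | h
    · have := key a b p1.1 h hn hab
      omega
    · have := key b a p2.1 h (by omega) (by rwa [mul_comm])
      rw [add_comm b a] at this
      omega
  | @mul a b j k h1 h2 ih1 ih2 =>
    have p1 := h1.pos
    have p2 := h2.pos
    have i1 := ih1 (by nlinarith)
    have i2 := ih2 (by nlinarith)
    have key : ∀ a b : ℕ, 1 ≤ a → 1 ≤ b → a ≤ b → a * b < 684 → tab (a * b) ≤ tab a + tab b := by
      intro a b ha hb hab hlt
      have ha27 : a < 27 := by nlinarith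
      have h3 : b ≤ 683 / a := (Nat.le_div_iff_mul_le (by omega)).2 (by nlinarith)
      have := tab_mul_le a ha27 b (by omega)
      omega
    rcases le_total a b with h | h
    · have := key a b p1.1 p2.1 h hn
      omega
    · have := key b a p2.1 p1.1 h (by rwa [mul_comm])
      rw [mul_comm b a] at this
      omega

lemma canWrite_tab (n : ℕ) (hn : 1 ≤ n) (hn' : n < 684) : CanWrite n (tab n) := by
  induction n using Nat.strong_induction_on with
  | _ n ih =>
    rcases Nat.lt_or_ge n 2 with h | h
    · obtain rfl : n = 1 := by omega
      have : tab 1 = 1 := by decide +kernel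
      rw [this]
      exact CanWrite.one
    rcases tab_wit n hn' h with h1 | ⟨a, ha, ha2, h1 | h1⟩
    · have := CanWrite.add (ih (n - 1) (by omega) (by omega) (by omega)) (ih 1 (by omega) le_rfl (by omega))
      rwa [h1, Nat.sub_add_cancel hn] at this
    · have := CanWrite.add (ih (n - a) (by omega) (by omega) (by omega)) (ih a (by omega) (by omega) (by omega))
      rwa [h1.2, Nat.sub_add_cancel (by omega)] at this
    · have hpos : 1 ≤ n / a := by
        refine Nat.one_le_iff_ne_zero.2 fun h0 => ?_
        rw [h0, mul_zero] at h1
        omega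
      have hlt : n / a < n := Nat.div_lt_self (by omega) (by omega)
      have hlt2 : a < n ∨ n / a = 1 := by
        by_contra hc
        have : 2 ≤ n / a := by omega
        have : a * 2 ≤ a * (n / a) := Nat.mul_le_mul_left a this
        omega
      rcases hlt2 with hlt2 | hlt2
      · have := CanWrite.mul (ih a hlt2 (by omega) (by omega)) (ih (n / a) hlt hpos (by omega))
        rwa [h1.2, h1.1] at this
      · exfalso
        have t1 : tab 1 = 1 := by decide +kernel
        rw [hlt2] at h1
        have : a = n := by omega
        subst this
        omega

lemma cpx_eq_tab {n : ℕ} (hn : 1 ≤ n) (hn' : n < 684) : cpx n = tab n :=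
  le_antisymm (cpx_le (canWrite_tab n hn hn')) (tab_le (cpx_spec hn) hn')

/-! ### Classification of numbers with `3 ^ ‖n‖ ≤ 4 * n ^ 3` -/

/-- The basic building blocks, with their complexities. -/
def Blk (q c : ℕ) : Prop :=
  (q = 25 ∧ c = 10) ∨ (∃ t, 2 ≤ t ∧ q = 3 ^ t + 1 ∧ c = 3 * t + 1) ∨
  (∃ t, 1 ≤ t ∧ q = 2 * 3 ^ t + 1 ∧ c = 3 * t + 3) ∨
  (∃ t, q = 4 * 3 ^ t + 1 ∧ c = 3 * t + 5)

/-- Numbers of the shape `2 ^ i * 3 ^ j * q` where `q = 1` or `q` is a building block. -/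
def Form (n k : ℕ) : Prop :=
  ∃ i j q c, n = 2 ^ i * 3 ^ j * q ∧ k = 2 * i + 3 * j + c ∧ ((q = 1 ∧ c = 0) ∨ Blk q c)

lemma blk_bound {q c : ℕ} (h : Blk q c) : (q = 5 ∧ c = 5) ∨ 729 * q ^ 3 ≤ 343 * 3 ^ c := by
  rcases h with ⟨rfl, rfl⟩ | ⟨t, ht, rfl, rfl⟩ | ⟨t, ht, rfl, rfl⟩ | ⟨t, rfl, rfl⟩
  · right; norm_num
  · right
    have hx : 3 ^ 2 ≤ 3 ^ t := Nat.pow_le_pow_right (by norm_num) ht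
    rw [pow_add, mul_comm 3 t, pow_mul]
    generalize 3 ^ t = x at *
    have h1 : 9 * (x + 1) ≤ 10 * x := by omega
    have h2 := Nat.pow_le_pow_left h1 3
    rw [mul_pow, mul_pow] at h2
    omega
  · right
    have hx : 3 ^ 1 ≤ 3 ^ t := Nat.pow_le_pow_right (by norm_num) ht
    rw [pow_add, mul_comm 3 t, pow_mul]
    generalize 3 ^ t = x at *
    have h1 : 9 * (2 * x + 1) ≤ 21 * x := by omega
    have h2 := Nat.pow_le_pow_left h1 3
    rw [mul_pow, mul_pow] at h2
    omega
  · rcases Nat.eq_zero_or_pos t with rfl | ht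
    · left; norm_num
    right
    have hx : 3 ^ 1 ≤ 3 ^ t := Nat.pow_le_pow_right (by norm_num) ht
    rw [pow_add, mul_comm 3 t, pow_mul]
    generalize 3 ^ t = x at *
    have h1 : 9 * (4 * x + 1) ≤ 39 * x := by omega
    have h2 := Nat.pow_le_pow_left h1 3
    rw [mul_pow, mul_pow] at h2
    omega

lemma blk_bound' {q c : ℕ} (h : Blk q c) : 243 * q ^ 3 ≤ 125 * 3 ^ c := by
  rcases blk_bound h with ⟨rfl, rfl⟩ | h
  · norm_num
  · omega

lemma blk_pos {q c : ℕ} (h : Blk q c) : 1 ≤ q := by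
  rcases h with ⟨rfl, rfl⟩ | ⟨t, ht, rfl, rfl⟩ | ⟨t, ht, rfl, rfl⟩ | ⟨t, rfl, rfl⟩ <;> simp

/-- Cancelling the factor `2 ^ i * 3 ^ j`. -/
lemma form_cancel {i j q c A B : ℕ} (h : A * 3 ^ (2 * i + 3 * j + c) ≤ B * (2 ^ i * 3 ^ j * q) ^ 3) :
    A * 9 ^ i * 3 ^ c ≤ B * 8 ^ i * q ^ 3 := by
  have e1 : A * 3 ^ (2 * i + 3 * j + c) = (A * 9 ^ i * 3 ^ c) * 27 ^ j := by
    rw [pow_add, pow_add, pow_mul, pow_mul]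
    norm_num
    ring
  have e2 : B * (2 ^ i * 3 ^ j * q) ^ 3 = (B * 8 ^ i * q ^ 3) * 27 ^ j := by
    rw [mul_pow, mul_pow, ← pow_mul, ← pow_mul, mul_comm i 3, mul_comm j 3, pow_mul, pow_mul]
    norm_num
    ring
  rw [e1, e2] at h
  exact Nat.le_of_mul_le_mul_right h (by positivity)

lemma form_cancel' {i j q c A B : ℕ} (h : A * 3 ^ (2 * i + 3 * j + c) ≤ B * (2 ^ i * 3 ^ j * q) ^ 3) :
    A * 3 ^ c ≤ B * q ^ 3 := by
  have h1 := form_cancel h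
  have h2 : 8 ^ i ≤ 9 ^ i := Nat.pow_le_pow_left (by norm_num) i
  have h3 : 0 < 8 ^ i := by positivity
  refine Nat.le_of_mul_le_mul_right (c := 8 ^ i) ?_ h3
  nlinarith [Nat.mul_le_mul_left (A * 3 ^ c) h2]

lemma form_mul {a b k l : ℕ} (ha : Form a k) (hb : Form b l)
    (hE : 3 ^ (k + l) ≤ 4 * (a * b) ^ 3) : Form (a * b) (k + l) := by
  obtain ⟨i, j, q, c, rfl, rfl, hq⟩ := ha
  obtain ⟨i', j', q', c', rfl, rfl, hq'⟩ := hb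
  have hE' : 1 * 3 ^ (2 * (i + i') + 3 * (j + j') + (c + c')) ≤
      4 * (2 ^ (i + i') * 3 ^ (j + j') * (q * q')) ^ 3 := by
    calc _ = 3 ^ (2 * i + 3 * j + c + (2 * i' + 3 * j' + c')) := by ring
      _ ≤ _ := hE
      _ = _ := by ring
  refine ⟨i + i', j + j', q * q', c + c', by ring, by ring, ?_⟩
  rcases hq with ⟨rfl, rfl⟩ | hq
  · simpa using hq'
  rcases hq' with ⟨rfl, rfl⟩ | hq'
  · right; simpa using hq
  right
  have h := form_cancel' hE'
  rw [pow_add, mul_pow, one_mul] at h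
  have p1 : 0 < q ^ 3 := by have := blk_pos hq; positivity
  have p2 : 0 < q' ^ 3 := by have := blk_pos hq'; positivity
  have b1 := blk_bound' hq
  have b2 := blk_bound' hq'
  have p3 : 0 < q ^ 3 * q' ^ 3 := by positivity
  rcases blk_bound hq with ⟨rfl, rfl⟩ | c1
  · rcases blk_bound hq' with ⟨rfl, rfl⟩ | c2
    · left; norm_num
    · exfalso
      have := Nat.mul_le_mul b1 c2
      nlinarith
  · exfalso
    have := Nat.mul_le_mul c1 b2
    nlinarith

lemma small_form : ∀ n < 47, 2 ≤ n → 3 ^ tab n ≤ 4 * n ^ 3 → ∃ i < 6, ∃ j < 4,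
    ∃ p ∈ [(1, 0), (5, 5), (7, 6), (13, 8), (19, 9), (25, 10), (37, 11)],
      n = 2 ^ i * 3 ^ j * p.1 ∧ tab n = 2 * i + 3 * j + p.2 := by
  decide +kernel

lemma classify (n : ℕ) (hn : 2 ≤ n) (hE : 3 ^ cpx n ≤ 4 * n ^ 3) : Form n (cpx n) := by
  induction n using Nat.strong_induction_on with
  | _ n ih =>
    rcases Nat.lt_or_ge n 47 with hs | hs
    · rw [cpx_eq_tab (by omega) (by omega)] at hE ⊢
      obtain ⟨i, _, j, _, ⟨q, c⟩, hp, h1, h2⟩ := small_form n hs hn hE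
      refine ⟨i, j, q, c, h1, h2, ?_⟩
      simp only [List.mem_cons, Prod.mk.injEq, List.not_mem_nil, or_false] at hp
      rcases hp with h | h | h | h | h | h | h
      · exact Or.inl h
      · exact Or.inr (Or.inr (Or.inr (Or.inr ⟨0, by omega⟩)))
      · exact Or.inr (Or.inr (Or.inr (Or.inl ⟨1, by omega⟩)))
      · exact Or.inr (Or.inr (Or.inr (Or.inr ⟨1, by omega⟩)))
      · exact Or.inr (Or.inr (Or.inr (Or.inl ⟨2, by omega⟩)))
      · exact Or.inr (Or.inl h)
      · exact Or.inr (Or.inr (Or.inr (Or.inr ⟨2, by omega⟩)))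
    have hE12 : 3 ^ cpx n ≤ 12 * n ^ 3 := by omega
    rcases cpx_step_small hn hE12 with ⟨a, b, ha, hb, rfl, hc⟩ | hc
    · have h1 := cube_le_cpx (n := a) (by omega)
      have h2 := cube_le_cpx (n := b) (by omega)
      have hE2 := hE
      rw [hc, pow_add, mul_pow] at hE2
      have pa : 0 < a ^ 3 := by positivity
      have pb : 0 < b ^ 3 := by positivity
      have ea : 3 ^ cpx a ≤ 4 * a ^ 3 := by
        refine Nat.le_of_mul_le_mul_right (c := b ^ 3) ?_ pb
        nlinarith [Nat.mul_le_mul_left (3 ^ cpx a) h2]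
      have eb : 3 ^ cpx b ≤ 4 * b ^ 3 := by
        refine Nat.le_of_mul_le_mul_left (c := a ^ 3) ?_ pa
        nlinarith [Nat.mul_le_mul_right (3 ^ cpx b) h1]
      rw [hc] at hE ⊢
      exact form_mul (ih a (by nlinarith) ha ea) (ih b (by nlinarith) hb eb) hE
    · obtain ⟨m, rfl⟩ : ∃ m, n = m + 1 := ⟨n - 1, by omega⟩
      rw [Nat.add_sub_cancel] at hc
      rw [hc, pow_succ] at hE
      have h1 : 46 * (m + 1) ≤ 47 * m := by omega
      have h2 := Nat.pow_le_pow_left h1 3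
      rw [mul_pow, mul_pow] at h2
      have pm : 0 < m ^ 3 := by have : 0 < m := by omega
                                positivity
      have h3 : 512 * 3 ^ cpx m < 729 * m ^ 3 := by omega
      have hF := ih m (by omega) (by omega) (by omega)
      obtain ⟨i, j, q, c, hm, hk, hq⟩ := hF
      have h4 : 512 * 3 ^ (2 * i + 3 * j + c) ≤ 729 * (2 ^ i * 3 ^ j * q) ^ 3 := by
        rw [← hk, ← hm]; omega
      have hq1 : q = 1 ∧ c = 0 := by
        rcases hq with h | h
        · exact h
        · exfalso
          have := form_cancel' h4
          have := blk_bound' h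
          have : 0 < q ^ 3 := by have := blk_pos h; positivity
          omega
      obtain ⟨rfl, rfl⟩ := hq1
      have hi : i ≤ 2 := by
        by_contra hcon
        obtain ⟨d, rfl⟩ : ∃ d, i = 3 + d := ⟨i - 3, by omega⟩
        have e : 729 * m ^ 3 ≤ 512 * 3 ^ cpx m := by
          rw [hk, hm]
          have h8 : 8 ^ d ≤ 9 ^ d := Nat.pow_le_pow_left (by norm_num) d
          have e1 : 512 * 3 ^ (2 * (3 + d) + 3 * j + 0) = 512 * 729 * 27 ^ j * 9 ^ d := by
            rw [pow_add, pow_add, pow_mul, pow_mul]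
            norm_num
            ring
          have e2 : 729 * (2 ^ (3 + d) * 3 ^ j * 1) ^ 3 = 512 * 729 * 27 ^ j * 8 ^ d := by
            rw [mul_pow, mul_pow, ← pow_mul, ← pow_mul, mul_comm (3 + d) 3, mul_comm j 3,
              pow_mul, pow_mul]
            norm_num
            ring
          rw [e1, e2]
          exact Nat.mul_le_mul_left _ h8
        omega
      have hj : 2 ≤ j := by
        by_contra hcon
        have h5 : 2 ^ i ≤ 2 ^ 2 := Nat.pow_le_pow_right (by norm_num) hi
        have h6 : 3 ^ j ≤ 3 ^ 1 := Nat.pow_le_pow_right (by norm_num) (by omega)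
        have := Nat.mul_le_mul h5 h6
        omega
      refine ⟨0, 0, m + 1, cpx m + 1, by ring, by omega, Or.inr ?_⟩
      interval_cases i
      · exact Or.inr (Or.inl ⟨j, hj, by omega, by omega⟩)
      · exact Or.inr (Or.inr (Or.inl ⟨j, by omega, by omega, by omega⟩))
      · exact Or.inr (Or.inr (Or.inr ⟨j, by omega, by omega⟩))

/-! ### Multiples of three of small defect -/

lemma cpx_pow_three_mul_le {n : ℕ} (hn : 1 ≤ n) (k : ℕ) : cpx (3 ^ k * n) ≤ 3 * k + cpx n := by
  induction k with
  | zero => simp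
  | succ k ih =>
    have h1 : 1 ≤ 3 ^ k * n := Nat.mul_pos (by positivity) hn
    have h2 := cpx_mul_le (a := 3) (b := 3 ^ k * n) (by norm_num) h1
    have h3 := cpx_le_self (n := 3) (by norm_num)
    rw [show 3 ^ (k + 1) * n = 3 * (3 ^ k * n) by ring]
    omega

lemma cpx_succ_le {n : ℕ} (hn : 1 ≤ n) : cpx (n + 1) ≤ cpx n + 1 := by
  have h1 := cpx_add_le hn (le_refl 1)
  have h2 := cpx_le_self (n := 1) le_rfl
  omega

lemma exponent_lt {A B i : ℕ} (K : ℕ) (h : A * 9 ^ i ≤ B * 8 ^ i) (hK : B * 8 ^ K < A * 9 ^ K) :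
    i < K := by
  by_contra hc
  obtain ⟨d, rfl⟩ : ∃ d, i = K + d := ⟨i - K, by omega⟩
  have h8 : 8 ^ d ≤ 9 ^ d := Nat.pow_le_pow_left (by norm_num) d
  have h9 : 0 < 9 ^ d := by positivity
  have : B * 8 ^ (K + d) < A * 9 ^ (K + d) := by
    calc B * 8 ^ (K + d) = B * 8 ^ K * 8 ^ d := by ring
      _ ≤ B * 8 ^ K * 9 ^ d := Nat.mul_le_mul_left _ h8
      _ < A * 9 ^ K * 9 ^ d := Nat.mul_lt_mul_of_pos_right hK h9
      _ = A * 9 ^ (K + d) := by ring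
  omega

lemma cancel_cube {A P Q i X Y C : ℕ} (h : 1 * 9 ^ i * C ≤ 4 * 8 ^ i * Y) (hC : C = A * X)
    (h2 : P * Y ≤ Q * X) (hX : 0 < X) : (A * P) * 9 ^ i ≤ (4 * Q) * 8 ^ i := by
  subst hC
  refine Nat.le_of_mul_le_mul_right (c := X) ?_ hX
  calc A * P * 9 ^ i * X = P * (1 * 9 ^ i * (A * X)) := by ring
    _ ≤ P * (4 * 8 ^ i * Y) := Nat.mul_le_mul_left _ h
    _ = 4 * 8 ^ i * (P * Y) := by ring
    _ ≤ 4 * 8 ^ i * (Q * X) := Nat.mul_le_mul_left _ h2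
    _ = 4 * Q * 8 ^ i * X := by ring

lemma eq_pow_three {b : ℕ} (hb : 2 ≤ b) (h : 8 * 3 ^ cpx b < 9 * b ^ 3) :
    ∃ j, b = 3 ^ (j + 1) ∧ cpx b = 3 * (j + 1) := by
  obtain ⟨i, j, q, c, hm, hk, hq⟩ := classify b hb (by omega)
  have h4 : 8 * 3 ^ (2 * i + 3 * j + c) ≤ 9 * (2 ^ i * 3 ^ j * q) ^ 3 := by
    rw [← hk, ← hm]; omega
  have hq1 : q = 1 ∧ c = 0 := by
    rcases hq with h | h
    · exact h
    · exfalso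
      have := form_cancel' h4
      have := blk_bound' h
      have : 0 < q ^ 3 := by have := blk_pos h; positivity
      omega
  obtain ⟨rfl, rfl⟩ := hq1
  have h5 : 8 * 3 ^ (2 * i + 3 * j + 0) + 1 ≤ 9 * (2 ^ i * 3 ^ j * 1) ^ 3 := by
    rw [← hk, ← hm]; omega
  have hi : i = 0 := by
    by_contra hcon
    obtain ⟨d, rfl⟩ : ∃ d, i = d + 1 := ⟨i - 1, by omega⟩
    have h8 : 8 ^ d ≤ 9 ^ d := Nat.pow_le_pow_left (by norm_num) d
    have e1 : 8 * 3 ^ (2 * (d + 1) + 3 * j + 0) = 72 * 27 ^ j * 9 ^ d := by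
      rw [pow_add, pow_add, pow_mul, pow_mul]
      norm_num
      ring
    have e2 : 9 * (2 ^ (d + 1) * 3 ^ j * 1) ^ 3 = 72 * 27 ^ j * 8 ^ d := by
      rw [mul_pow, mul_pow, ← pow_mul, ← pow_mul, mul_comm (d + 1) 3, mul_comm j 3,
        pow_mul, pow_mul]
      norm_num
      ring
    rw [e1, e2] at h5
    have := Nat.mul_le_mul_left (72 * 27 ^ j) h8
    omega
  subst hi
  have hj : j ≠ 0 := by
    rintro rfl
    simp at hm
    omega
  refine ⟨j - 1, ?_, by omega⟩
  rw [show j - 1 + 1 = j by omega, hm]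
  ring

lemma main_small : ∀ r < 111, 1 ≤ r → 1225043 * 3 ^ tab (3 * r) ≤ 14348907 * (3 * r) ^ 3 →
    r = 1 ∨ r = 107 ∨ tab r + 3 ≤ tab (3 * r) := by
  decide +kernel

/-- The additive case: `3 * r - 1` has small defect. -/
lemma main_pred {r a : ℕ} (hr : 3 * r = a + 1) (ha : 332 ≤ a) (hc : cpx (3 * r) = cpx a + 1)
    (hE : 3 ^ cpx a ≤ 4 * a ^ 3) :
    (r = 683 ∧ cpx (3 * 683) = 23) ∨ cpx r + 3 ≤ cpx (3 * r) := by
  obtain ⟨i, j, q, c, hm, hk, hq⟩ := classify a (by omega) hE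
  have hj : j = 0 := by
    by_contra hcon
    obtain ⟨s, rfl⟩ : ∃ s, j = s + 1 := ⟨j - 1, by omega⟩
    have : a = 3 * (2 ^ i * 3 ^ s * q) := by rw [hm]; ring
    omega
  subst hj
  have hB := form_cancel (A := 1) (B := 4) (i := i) (j := 0) (q := q) (c := c)
    (by rw [← hk, ← hm]; omega)
  rw [pow_zero, mul_one] at hm
  have t2 : cpx 2 ≤ 2 := cpx_le_self (by norm_num)
  have t4 : cpx 4 ≤ 4 := cpx_le_self (by norm_num)
  have t8 : cpx 8 ≤ 6 := by
    have h := cpx_mul_le (a := 2) (b := 4) (by norm_num) (by norm_num)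
    norm_num at h
    omega
  rcases hq with ⟨rfl, rfl⟩ | ⟨rfl, rfl⟩ | ⟨t, ht, rfl, rfl⟩ | ⟨t, ht, rfl, rfl⟩ | ⟨t, rfl, rfl⟩
  · have hi : i < 12 := exponent_lt (A := 1) (B := 4) 12 (by omega) (by norm_num)
    have h171 : cpx 171 = 15 := by
      rw [cpx_eq_tab (by norm_num) (by norm_num)]
      decide +kernel
    interval_cases i
    all_goals first | omega | skip
    · obtain rfl : r = 171 := by omega
      omega
    · obtain rfl : r = 683 := by omega
      omega
  · have hi : i < 1 := exponent_lt (A := 59049) (B := 62500) 1 (by omega) (by norm_num)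
    interval_cases i
    omega
  · have hi6 : i < 6 := by
      have hx : 3 ^ 2 ≤ 3 ^ t := Nat.pow_le_pow_right (by norm_num) ht
      have h1 : 9 * (3 ^ t + 1) ≤ 10 * 3 ^ t := by omega
      have h2 := Nat.pow_le_pow_left h1 3
      rw [mul_pow, mul_pow 10] at h2
      exact exponent_lt 6 (cancel_cube (A := 3) hB (by ring) h2 (by positivity)) (by norm_num)
    rcases Nat.lt_or_ge t 3 with ht3 | ht3
    · obtain rfl : t = 2 := by omega
      interval_cases i <;> omega
    have hi4 : i < 4 := by
      have hx : 3 ^ 3 ≤ 3 ^ t := Nat.pow_le_pow_right (by norm_num) ht3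
      have h1 : 27 * (3 ^ t + 1) ≤ 28 * 3 ^ t := by omega
      have h2 := Nat.pow_le_pow_left h1 3
      rw [mul_pow, mul_pow 28] at h2
      exact exponent_lt 4 (cancel_cube (A := 3) hB (by ring) h2 (by positivity)) (by norm_num)
    obtain ⟨s, rfl⟩ : ∃ s, t = s + 2 := ⟨t - 2, by omega⟩
    have hx : 3 ^ (s + 2) = 9 * 3 ^ s := by ring
    have hs : 0 < 3 ^ s := by positivity
    right
    interval_cases i
    · omega
    · have e : r = 3 ^ (s + 1) * 2 + 1 := by
        rw [pow_succ]; omega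
      have h1 := cpx_succ_le (n := 3 ^ (s + 1) * 2) (Nat.mul_pos (by positivity) (by norm_num))
      have h2 := cpx_pow_three_mul_le (n := 2) (by norm_num) (s + 1)
      rw [← e] at h1
      omega
    · omega
    · have e : r = 3 * (3 ^ s * 8 + 1) := by omega
      have h1 := cpx_succ_le (n := 3 ^ s * 8) (Nat.mul_pos (by positivity) (by norm_num))
      have h2 := cpx_pow_three_mul_le (n := 8) (by norm_num) s
      have h3 := cpx_mul_le (a := 3) (b := 3 ^ s * 8 + 1) (by norm_num) (by omega)
      have h4 := cpx_le_self (n := 3) (by norm_num)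
      rw [← e] at h3
      omega
  · rcases Nat.lt_or_ge t 2 with ht2 | ht2
    · obtain rfl : t = 1 := by omega
      have hi : i < 6 := exponent_lt (A := 729) (B := 1372) 6 (by omega) (by norm_num)
      interval_cases i <;> omega
    have hi3 : i < 3 := by
      have hx : 3 ^ 2 ≤ 3 ^ t := Nat.pow_le_pow_right (by norm_num) ht2
      have h1 : 9 * (2 * 3 ^ t + 1) ≤ 19 * 3 ^ t := by omega
      have h2 := Nat.pow_le_pow_left h1 3
      rw [mul_pow, mul_pow 19] at h2
      exact exponent_lt 3 (cancel_cube (A := 27) hB (by ring) h2 (by positivity)) (by norm_num)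
    obtain ⟨s, rfl⟩ : ∃ s, t = s + 1 := ⟨t - 1, by omega⟩
    have hx : 3 ^ (s + 1) = 3 * 3 ^ s := by ring
    right
    interval_cases i
    · omega
    · have e : r = 3 ^ s * 4 + 1 := by omega
      have h1 := cpx_succ_le (n := 3 ^ s * 4) (Nat.mul_pos (by positivity) (by norm_num))
      have h2 := cpx_pow_three_mul_le (n := 4) (by norm_num) s
      rw [← e] at h1
      omega
    · omega
  · rcases Nat.lt_or_ge t 1 with ht1 | ht1
    · obtain rfl : t = 0 := by omega
      have hi : i < 7 := exponent_lt (A := 243) (B := 500) 7 (by omega) (by norm_num)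
      interval_cases i <;> omega
    have hi3 : i < 3 := by
      have hx : 3 ^ 1 ≤ 3 ^ t := Nat.pow_le_pow_right (by norm_num) ht1
      have h1 : 3 * (4 * 3 ^ t + 1) ≤ 13 * 3 ^ t := by omega
      have h2 := Nat.pow_le_pow_left h1 3
      rw [mul_pow, mul_pow 13] at h2
      exact exponent_lt 3 (cancel_cube (A := 243) hB (by ring) h2 (by positivity)) (by norm_num)
    obtain ⟨s, rfl⟩ : ∃ s, t = s + 1 := ⟨t - 1, by omega⟩
    have hx : 3 ^ (s + 1) = 3 * 3 ^ s := by ring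
    right
    interval_cases i
    · omega
    · have e : r = 3 ^ s * 8 + 1 := by omega
      have h1 := cpx_succ_le (n := 3 ^ s * 8) (Nat.mul_pos (by positivity) (by norm_num))
      have h2 := cpx_pow_three_mul_le (n := 8) (by norm_num) s
      rw [← e] at h1
      omega
    · omega

/-- Except for `r = 1, 107, 683`, multiples `3 * r` of small defect cost three more than `r`. -/
lemma main_claim (r : ℕ) (hr : 1 ≤ r) (hE : 1225043 * 3 ^ cpx (3 * r) ≤ 14348907 * (3 * r) ^ 3) :
    r = 1 ∨ r = 107 ∨ (r = 683 ∧ cpx (3 * 683) = 23) ∨ cpx r + 3 ≤ cpx (3 * r) := by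
  induction r using Nat.strong_induction_on with
  | _ r ih =>
    rcases Nat.lt_or_ge r 111 with hs | hs
    · rw [cpx_eq_tab (n := 3 * r) (by omega) (by omega)] at hE ⊢
      rw [cpx_eq_tab (n := r) (by omega) (by omega)]
      rcases main_small r hs hr hE with h | h | h
      · exact Or.inl h
      · exact Or.inr (Or.inl h)
      · exact Or.inr (Or.inr (Or.inr h))
    right; right
    have key : ∀ a b, 2 ≤ a → 2 ≤ b → 3 * r = a * b → cpx (3 * r) = cpx a + cpx b → 3 ∣ a →
        cpx r + 3 ≤ cpx (3 * r) := by
      rintro a b ha hb hab hc ⟨s, rfl⟩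
      have hrs : r = s * b := by
        have : 3 * r = 3 * (s * b) := by rw [hab]; ring
        omega
      have hs1 : 1 ≤ s := by omega
      have hsr : s < r := by nlinarith
      have hb3 := cube_le_cpx (n := b) (by omega)
      have pb : 0 < b ^ 3 := by positivity
      rw [hab, mul_pow] at hE
      rw [← hab, hc, pow_add] at hE
      have hEs : 1225043 * 3 ^ cpx (3 * s) ≤ 14348907 * (3 * s) ^ 3 := by
        refine Nat.le_of_mul_le_mul_right (c := b ^ 3) ?_ pb
        nlinarith [Nat.mul_le_mul_left (3 ^ cpx (3 * s)) hb3]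
      have fin : 8 * 3 ^ cpx b < 9 * b ^ 3 → cpx r + 3 ≤ cpx (3 * r) := by
        intro hlt
        obtain ⟨j, hj, hj'⟩ := eq_pow_three hb hlt
        have h1 := cpx_pow_three_mul_le (n := 3 * s) (by omega) j
        have h2 : r = 3 ^ j * (3 * s) := by rw [hrs, hj]; ring
        rw [← h2] at h1
        omega
      rcases ih s hsr hs1 hEs with h | h | h | h
      · subst h
        have h3 : cpx (3 * 1) = 3 := by
          rw [cpx_eq_tab (by norm_num) (by norm_num)]
          decide +kernel
        rw [one_mul] at hrs
        rw [hc, h3, hrs]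
        omega
      · subst h
        have h3 : cpx (3 * 107) = 18 := by
          rw [cpx_eq_tab (by norm_num) (by norm_num)]
          decide +kernel
        rw [h3] at hE
        exact fin (by omega)
      · obtain ⟨rfl, h3⟩ := h
        rw [h3] at hE
        exact fin (by omega)
      · have := cpx_mul_le (a := s) (b := b) hs1 (by omega)
        rw [← hrs] at this
        omega
    rcases cpx_step_small (n := 3 * r) (by omega) (by omega) with ⟨a, b, ha, hb, hab, hc⟩ | hc
    · right
      have hd : 3 ∣ a * b := ⟨r, hab.symm⟩
      rcases (Nat.Prime.dvd_mul Nat.prime_three).1 hd with h | h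
      · exact key a b ha hb hab hc h
      · exact key b a hb ha (by rw [hab, mul_comm]) (by rw [hc, add_comm]) h
    · obtain ⟨a, ha⟩ : ∃ a, 3 * r = a + 1 := ⟨3 * r - 1, by omega⟩
      rw [show 3 * r - 1 = a by omega] at hc
      refine main_pred ha (by omega) hc ?_
      rw [hc, pow_succ, ha] at hE
      have h1 : 332 * (a + 1) ≤ 333 * a := by omega
      have h2 := Nat.pow_le_pow_left h1 3
      rw [mul_pow, mul_pow] at h2
      omega

lemma cpx_107 : cpx 107 = 16 := by
  rw [cpx_eq_tab (by norm_num) (by norm_num)]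
  decide +kernel

lemma cpx_321 : cpx 321 = 18 := by
  rw [cpx_eq_tab (by norm_num) (by norm_num)]
  decide +kernel

lemma cpx_683 : cpx 683 = 22 := by
  rw [cpx_eq_tab (by norm_num) (by norm_num)]
  decide +kernel

/-- Comparing defects with that of 107 amounts to an inequality of integers. -/
lemma defect_le_107 {n : ℕ} (hn : 1 ≤ n) (h : defect n ≤ defect 107) :
    1225043 * 3 ^ cpx n ≤ 43046721 * n ^ 3 := by
  unfold defect at h
  rw [cpx_107] at h
  have hn0 : (0 : ℝ) < n := by exact_mod_cast hn
  have h3 : Real.logb 3 (3 : ℝ) = 1 := Real.logb_self_eq_one (by norm_num)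
  have e1 : Real.logb 3 ((107 : ℝ) ^ 3 * 3 ^ cpx n) = 3 * Real.logb 3 107 + cpx n := by
    rw [Real.logb_mul (by positivity) (by positivity), Real.logb_pow, Real.logb_pow, h3]
    push_cast
    ring
  have e2 : Real.logb 3 ((3 : ℝ) ^ 16 * (n : ℝ) ^ 3) = 16 + 3 * Real.logb 3 n := by
    rw [Real.logb_mul (by positivity) (by positivity), Real.logb_pow, Real.logb_pow, h3]
    push_cast
    ring
  have hle : Real.logb 3 ((107 : ℝ) ^ 3 * 3 ^ cpx n) ≤ Real.logb 3 ((3 : ℝ) ^ 16 * (n : ℝ) ^ 3) := by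
    rw [e1, e2]
    push_cast at h
    linarith
  have := (Real.logb_le_logb (b := 3) (by norm_num) (by positivity) (by positivity)).1 hle
  have h' : 107 ^ 3 * 3 ^ cpx n ≤ 3 ^ 16 * n ^ 3 := by exact_mod_cast this
  norm_num at h'
  exact h'

theorem smallest_unstable_defect_is_107 :
    ¬ Stable 107 ∧
    ∀ n : ℕ, 1 < n → n ≠ 107 → ¬ Stable n → defect 107 < defect n := by
  constructor
  · intro h
    have h1 := h 1
    norm_num at h1
    rw [cpx_107, cpx_321] at h1
    omega
  intro n hn hn107 hns
  by_contra hlt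
  have hE := defect_le_107 (n := n) (by omega) (not_lt.1 hlt)
  classical
  have hex : ∃ k, ¬ cpx (3 ^ k * n) = 3 * k + cpx n := by
    unfold Stable at hns
    push Not at hns
    exact hns
  have hk := Nat.find_spec hex
  have hmin := fun m => Nat.find_min hex (m := m)
  generalize Nat.find hex = k at hk hmin
  have hk0 : k ≠ 0 := by
    rintro rfl
    simp at hk
  obtain ⟨l, rfl⟩ : ∃ l, k = l + 1 := ⟨k - 1, by omega⟩
  have hl : cpx (3 ^ l * n) = 3 * l + cpx n := not_not.1 (hmin l (by omega))
  have hr1 : 1 ≤ 3 ^ l * n := Nat.mul_pos (by positivity) (by omega)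
  have hup := cpx_pow_three_mul_le hr1 1
  rw [show 3 ^ (l + 1) * n = 3 * (3 ^ l * n) by ring] at hk
  rw [pow_one] at hup
  have hEr : 1225043 * 3 ^ cpx (3 ^ l * n) ≤ 43046721 * (3 ^ l * n) ^ 3 := by
    rw [hl]
    calc 1225043 * 3 ^ (3 * l + cpx n) = 3 ^ (3 * l) * (1225043 * 3 ^ cpx n) := by ring
      _ ≤ 3 ^ (3 * l) * (43046721 * n ^ 3) := Nat.mul_le_mul_left _ hE
      _ = 43046721 * (3 ^ l * n) ^ 3 := by ring
  have hdrop : cpx (3 * (3 ^ l * n)) + 1 ≤ cpx (3 ^ l * n) + 3 := by omega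
  have hpow : 3 ^ (cpx (3 * (3 ^ l * n)) + 1) ≤ 3 ^ (cpx (3 ^ l * n) + 3) :=
    Nat.pow_le_pow_right (by norm_num) hdrop
  rw [pow_succ, pow_add 3 _ 3] at hpow
  have hE3 : 1225043 * 3 ^ cpx (3 * (3 ^ l * n)) ≤ 14348907 * (3 * (3 ^ l * n)) ^ 3 := by
    rw [mul_pow 3 (3 ^ l * n) 3]
    omega
  rcases main_claim _ hr1 hE3 with h | h | h | h
  · have := Nat.eq_one_of_mul_eq_one_left h
    omega
  · rcases Nat.eq_zero_or_pos l with rfl | hl0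
    · rw [pow_zero, one_mul] at h
      exact hn107 h
    · obtain ⟨s, rfl⟩ : ∃ s, l = s + 1 := ⟨l - 1, by omega⟩
      rw [pow_succ, mul_comm (3 ^ s) 3, mul_assoc] at h
      omega
  · rw [h.1, cpx_683] at hEr
    norm_num at hEr
  · omega
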